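/- The Lorentz generators satisfy the orthogonality relations of the quantum Lorentz group: for each sign choice, Σ_{N,M} G_{±NM} Λ_L^N Λ_K^M = G_{±LK} · 1_A and Σ_{L,K} G_±^{LK} Λ_L^N Λ_K^M = G_±^{NM} · 1_A. -/

import Mathlib

noncomputable section

open scoped Matrix

/-- Lower undotted spinor metric `ε_{αβ}` of the two-parameter deformation. -/
def epsLo (q r : ℝ) : Matrix (Fin 2) (Fin 2) ℂ :=
  ((Real.sqrt (1 - r ^ 2) : ℂ))⁻¹ •
    !![Complex.I * (r : ℂ), -((Real.sqrt q : ℂ))⁻¹; (Real.sqrt q : ℂ), Complex.I * (r : ℂ)]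

/-- Upper undotted spinor metric `ε^{αβ}`. -/
def epsUp (q r : ℝ) : Matrix (Fin 2) (Fin 2) ℂ :=
  ((Real.sqrt (1 - r ^ 2) : ℂ))⁻¹ •
    !![Complex.I * (r : ℂ), ((Real.sqrt q : ℂ))⁻¹; -(Real.sqrt q : ℂ), Complex.I * (r : ℂ)]

/-- Lower dotted spinor metric `ε_{α̇β̇}`. -/
def epsLoD (q r : ℝ) : Matrix (Fin 2) (Fin 2) ℂ :=
  ((Real.sqrt (1 - r ^ 2) : ℂ))⁻¹ •
    !![-(Complex.I * (r : ℂ)), (Real.sqrt q : ℂ); -((Real.sqrt q : ℂ))⁻¹, -(Complex.I * (r : ℂ))]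

/-- Upper dotted spinor metric `ε^{α̇β̇}`. -/
def epsUpD (q r : ℝ) : Matrix (Fin 2) (Fin 2) ℂ :=
  ((Real.sqrt (1 - r ^ 2) : ℂ))⁻¹ •
    !![-(Complex.I * (r : ℂ)), -(Real.sqrt q : ℂ); ((Real.sqrt q : ℂ))⁻¹, -(Complex.I * (r : ℂ))]

/-- `Q = (2r + q + q⁻¹)/(1 − r²)`. -/
def Qval (q r : ℝ) : ℝ := (2 * r + q + q⁻¹) / (1 - r ^ 2)

/-- The R-matrix `R^{αβ}_{γδ} = δ^α_γ δ^β_δ + c · ε^{αβ} ε_{γδ}` (with `c = a^{±1}`). -/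
def Rm (q r : ℝ) (c : ℂ) (α β γ δ : Fin 2) : ℂ :=
  (if α = γ then 1 else 0) * (if β = δ then 1 else 0) + c * epsUp q r α β * epsLo q r γ δ

/-- The conjugate `σ̄_±^{α̇β} = a^{±1/2} Σ ε^{α̇λ̇} ε_{ρκ} R^{∓σκ}_{μν} ε^{μλ} ε^{νβ} σ_{σρ̇}`
of a 2×2 matrix `σ`; `s = true` is the `+` sign, `s = false` the `−` sign. -/
def sbar (q r a : ℝ) (s : Bool) (σ : Matrix (Fin 2) (Fin 2) ℂ) (ad b : Fin 2) : ℂ :=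
  (if s then (Real.sqrt a : ℂ) else ((Real.sqrt a : ℂ))⁻¹) *
    ∑ l, ∑ sg, ∑ rh, ∑ ka, ∑ mu, ∑ nu,
      epsUpD q r ad l * epsLo q r rh ka * Rm q r (if s then ((a : ℂ))⁻¹ else (a : ℂ)) sg ka mu nu *
        epsUp q r mu l * epsUp q r nu b * σ sg rh

/-- The quantum Pauli matrices `σ^0, σ^1, σ^2, σ^3`. -/
def pauli : Fin 4 → Matrix (Fin 2) (Fin 2) ℂ :=
  ![!![1, 0; 0, 1], !![0, 1; 1, 0], !![0, -Complex.I; Complex.I, 0], !![1, 0; 0, -1]]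

/-- The metric pairing `G_±^{IJ} = (1/Q) Σ ε^{αν} σ^I_{αβ̇} σ̄_±^{Jβ̇γ} ε_{γν}`. -/
def Gpair (q r a : ℝ) (s : Bool) (σI σJ : Matrix (Fin 2) (Fin 2) ℂ) : ℂ :=
  (1 / (Qval q r : ℂ)) * ∑ al, ∑ nu, ∑ be, ∑ ga,
    epsUp q r al nu * σI al be * sbar q r a s σJ be ga * epsLo q r ga nu

/-- The quantum Minkowski metric `G_±^{IJ}` as a 4×4 matrix. -/
def GupM (q r a : ℝ) (s : Bool) : Matrix (Fin 4) (Fin 4) ℂ :=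
  fun I J => Gpair q r a s (pauli I) (pauli J)

/-- The inverse metric `G_{±IJ}`. -/
def GloM (q r a : ℝ) (s : Bool) : Matrix (Fin 4) (Fin 4) ℂ := (GupM q r a s)⁻¹

/-- The lowered conjugate Pauli matrices `σ̄_L^{α̇β} = Σ_N G_{+LN} σ̄_+^{Nα̇β}`. -/
def sbarL (q r a : ℝ) (L : Fin 4) (ad b : Fin 2) : ℂ :=
  ∑ N, GloM q r a true L N * sbar q r a true (pauli N) ad b

/-- The quantum Lorentz group generators
`Λ_L^K = (1/Q) Σ ε_{γ̇δ̇} σ̄_L^{δ̇α} M_α^σ σ^K_{σρ̇} M̄_β̇^{ρ̇} ε^{γ̇β̇}`. -/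
def Lor {A : Type*} [Ring A] [Algebra ℂ A] (q r a : ℝ)
    (M Mb : Fin 2 → Fin 2 → A) (L K : Fin 4) : A :=
  ∑ ga, ∑ de, ∑ al, ∑ sg, ∑ rh, ∑ be,
    ((1 / (Qval q r : ℂ)) * epsLoD q r ga de * sbarL q r a L de al * pauli K sg rh *
      epsUpD q r ga be) • (M al sg * Mb be rh)

/-- The Lorentz R-matrices
`𝓡^{±NM}_{LK} = (1/Q²) Σ R^{∓ακ}_{τσ} R^{∓μβ}_{κν} R^{±ρξ}_{δα} R^{±λγ}_{ξμ}
σ^{M β̇}_γ σ^{N λ̇}_ρ σ̄_{Lτ̇}^δ σ̄_{Kν̇}^σ`. -/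
def Rlor (q r a : ℝ) (s : Bool) (N M L K : Fin 4) : ℂ :=
  (1 / (Qval q r : ℂ) ^ 2) *
    ∑ al, ∑ be, ∑ ga, ∑ de, ∑ ka, ∑ l, ∑ mu, ∑ nu, ∑ xi, ∑ rh, ∑ sg, ∑ ta,
      Rm q r (if s then ((a : ℂ))⁻¹ else (a : ℂ)) al ka ta sg *
        Rm q r (if s then ((a : ℂ))⁻¹ else (a : ℂ)) mu be ka nu *
          Rm q r (if s then (a : ℂ) else ((a : ℂ))⁻¹) rh xi de al *
            Rm q r (if s then (a : ℂ) else ((a : ℂ))⁻¹) l ga xi mu *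
              (∑ p, epsUpD q r be p * pauli M ga p) *
                (∑ p, epsUpD q r l p * pauli N rh p) *
                  (∑ p, epsLoD q r ta p * sbarL q r a L p de) *
                    (∑ p, epsLoD q r nu p * sbarL q r a K p sg)

end

open Matrix in
theorem Matrix.transpose_map_algebraMap_mul {R A l m n : Type*} [CommSemiring R] [Semiring A]
    [Algebra R A] [Fintype m] (C : Matrix l m R) (Y : Matrix m n A) :
    (C.map (algebraMap R A) * Y)ᵀ = Yᵀ * Cᵀ.map (algebraMap R A) := by
  ext i j
  simp only [transpose_apply, mul_apply, map_apply]
  exact Finset.sum_congr rfl fun _ _ => Algebra.commutes _ _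

open Matrix in
theorem Matrix.transpose_mul_map_algebraMap {R A l m n : Type*} [CommSemiring R] [Semiring A]
    [Algebra R A] [Fintype m] (Y : Matrix l m A) (C : Matrix m n R) :
    (Y * C.map (algebraMap R A))ᵀ = Cᵀ.map (algebraMap R A) * Yᵀ := by
  ext i j
  simp only [transpose_apply, mul_apply, map_apply]
  exact Finset.sum_congr rfl fun _ _ => (Algebra.commutes _ _).symm

open Matrix in
theorem Matrix.transpose_mul_map_mul_apply {R A m n : Type*} [CommSemiring R] [Semiring A]
    [Algebra R A] [Fintype m] (Y : Matrix m n A) (C : Matrix m m R) (Z : Matrix m n A) (i j : n) :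
    (Yᵀ * C.map (algebraMap R A) * Z) i j = ∑ k, ∑ l, C k l • (Y k i * Z l j) := by
  simp only [mul_apply, transpose_apply, map_apply, Finset.sum_mul]
  rw [Finset.sum_comm]
  refine Finset.sum_congr rfl fun k _ => Finset.sum_congr rfl fun l _ => ?_
  rw [← Algebra.commutes, Algebra.smul_def, mul_assoc]

open Matrix in
/-- An invertible matrix over a noncommutative algebra which preserves an invertible scalar
bilinear form also preserves the inverse form. -/
theorem Matrix.mul_map_inv_mul_transpose {R A n : Type*} [CommRing R] [Ring A] [Algebra R A]
    [Fintype n] [DecidableEq n] {Y : Matrix n n A} {G : Matrix n n R} (hY : IsUnit Y)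
    (hG : IsUnit G.det) (h : Yᵀ * G.map (algebraMap R A) * Y = G.map (algebraMap R A)) :
    Y * (G⁻¹).map (algebraMap R A) * Yᵀ = (G⁻¹).map (algebraMap R A) := by
  have h1 : (G⁻¹).map (algebraMap R A) * G.map (algebraMap R A) = 1 := by
    rw [← Matrix.map_mul, nonsing_inv_mul _ hG, Matrix.map_one _ (map_zero _) (map_one _)]
  have h2 : G.map (algebraMap R A) * (G⁻¹).map (algebraMap R A) = 1 := by
    rw [← Matrix.map_mul, mul_nonsing_inv _ hG, Matrix.map_one _ (map_zero _) (map_one _)]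
  have h3 : ((G⁻¹).map (algebraMap R A) * Yᵀ * G.map (algebraMap R A)) * Y = 1 := by
    rw [← h1, ← h]; simp only [Matrix.mul_assoc, h]
  have h4 : Y * ((G⁻¹).map (algebraMap R A) * Yᵀ * G.map (algebraMap R A)) = 1 := by
    obtain ⟨u, rfl⟩ := hY
    rw [left_inv_eq_right_inv h3 u.mul_inv, u.mul_inv]
  calc Y * (G⁻¹).map (algebraMap R A) * Yᵀ
      = Y * ((G⁻¹).map (algebraMap R A) * Yᵀ * G.map (algebraMap R A)) *
          (G⁻¹).map (algebraMap R A) := by simp only [Matrix.mul_assoc, h2, Matrix.mul_one]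
    _ = _ := by rw [h4, Matrix.one_mul]

open Matrix in
/-- A matrix preserving a scalar bilinear form and, from the other side, its inverse is
invertible. -/
theorem Matrix.isUnit_of_mul_map_mul_transpose {R A n : Type*} [CommSemiring R] [Semiring A]
    [Algebra R A] [Fintype n] [DecidableEq n] {Y : Matrix n n A} {G G' : Matrix n n R}
    (hG : G * G' = 1)
    (h : Y * G.map (algebraMap R A) * Yᵀ = G.map (algebraMap R A))
    (h' : Yᵀ * G'.map (algebraMap R A) * Y = G'.map (algebraMap R A)) : IsUnit Y := by
  have h1 : G.map (algebraMap R A) * G'.map (algebraMap R A) = 1 := by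
    rw [← Matrix.map_mul, hG, Matrix.map_one _ (map_zero _) (map_one _)]
  refine ⟨⟨Y, G.map (algebraMap R A) * Yᵀ * G'.map (algebraMap R A), ?_, ?_⟩, rfl⟩
  · rw [← Matrix.mul_assoc, ← Matrix.mul_assoc, h, h1]
  · rw [Matrix.mul_assoc, Matrix.mul_assoc, ← Matrix.mul_assoc Yᵀ, h', h1]

open Matrix in
/-- The tensor product of two matrices over a possibly noncommutative ring, entries being
multiplied from left to right. -/
def Matrix.tensor {A l m n p : Type*} [Mul A] (Y : Matrix l m A) (Z : Matrix n p A) :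
    Matrix (l × n) (m × p) A :=
  of fun x y => Y x.1 y.1 * Z x.2 y.2

open Matrix in
theorem Matrix.isUnit_tensor {A m n : Type*} [Ring A] [Fintype m] [DecidableEq m] [Fintype n]
    [DecidableEq n] {Y : Matrix m m A} {Z : Matrix n n A} (hY : IsUnit Y) (hZ : IsUnit Z) :
    IsUnit (Y.tensor Z) := by
  obtain ⟨⟨Y, Y', hY, hY'⟩, rfl⟩ := hY
  obtain ⟨⟨Z, Z', hZ, hZ'⟩, rfl⟩ := hZ
  refine ⟨⟨Y.tensor Z, of fun x y => Z' x.2 y.2 * Y' x.1 y.1, ?_, ?_⟩, rfl⟩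
  · ext ⟨i, j⟩ ⟨i', j'⟩
    calc _ = ∑ k, Y i k * (Z * Z') j j' * Y' k i' := by
          simp only [mul_apply, tensor, of_apply, Fintype.sum_prod_type, Finset.mul_sum,
            Finset.sum_mul, mul_assoc]
      _ = (Y * Y') i i' * (1 : Matrix n n A) j j' := by
          rw [hZ, mul_apply, Finset.sum_mul]
          refine Finset.sum_congr rfl fun k _ => ?_
          by_cases h : j = j' <;> simp [one_apply, h]
      _ = _ := by simp [hY, one_apply, ← ite_and, and_comm]
  · ext ⟨i, j⟩ ⟨i', j'⟩
    calc _ = ∑ k, Z' j k * (Y' * Y) i i' * Z k j' := by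
          simp only [mul_apply, tensor, of_apply, Fintype.sum_prod_type, Finset.mul_sum,
            Finset.sum_mul, mul_assoc]
          exact Finset.sum_comm
      _ = (1 : Matrix m m A) i i' * (Z' * Z) j j' := by
          rw [hY', mul_apply, Finset.mul_sum]
          refine Finset.sum_congr rfl fun k _ => ?_
          by_cases h : i = i' <;> simp [one_apply, h]
      _ = _ := by simp [hZ', one_apply, ← ite_and, and_comm]

section SpinorMetric

open scoped Matrix

variable {q r : ℝ}

theorem epsLo_mul_epsUp (hq : 0 < q) (hr : r ^ 2 < 1) : epsLo q r * epsUp q r = 1 := by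
  have hs : (Real.sqrt q : ℂ) ≠ 0 := by exact_mod_cast (Real.sqrt_pos.2 hq).ne'
  have hd : (Real.sqrt (1 - r ^ 2) : ℂ) ≠ 0 := by
    exact_mod_cast (Real.sqrt_pos.2 (sub_pos.2 hr)).ne'
  have hd2 : (Real.sqrt (1 - r ^ 2) : ℂ) ^ 2 = 1 - (r : ℂ) ^ 2 := by
    exact_mod_cast Real.sq_sqrt (sub_pos.2 hr).le
  ext i j
  fin_cases i <;> fin_cases j <;>
    simp [epsLo, epsUp, Matrix.mul_apply, Fin.sum_univ_two] <;> field_simp <;>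
    simp only [hd2, Complex.I_sq] <;> ring

theorem epsLoD_eq : epsLoD q r = -(epsUp q r)ᵀ := by
  ext i j
  fin_cases i <;> fin_cases j <;> simp [epsLoD, epsUp]

theorem epsUpD_eq : epsUpD q r = -(epsLo q r)ᵀ := by
  ext i j
  fin_cases i <;> fin_cases j <;> simp [epsUpD, epsLo]

/-- The matrix `h = ε_{··} (ε^{··})ᵀ` defining the quantum trace `tr (h σ)`. -/
noncomputable def traceMat (q r : ℝ) : Matrix (Fin 2) (Fin 2) ℂ := epsLo q r * (epsUp q r)ᵀ

/-- The matrix, on pairs of spinor indices, of the bilinear form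
`tr (h σ τ) + c · tr (h σ) tr (h τ)`. -/
noncomputable def spinorForm (q r : ℝ) (c : ℂ) : Matrix (Fin 2 × Fin 2) (Fin 2 × Fin 2) ℂ :=
  fun x y => traceMat q r y.2 x.1 * (if x.2 = y.1 then 1 else 0) +
    c * traceMat q r x.2 x.1 * traceMat q r y.2 y.1

theorem spinorForm_eq_sum_Rm (c : ℂ) (i k l j : Fin 2) :
    spinorForm q r c (i, k) (l, j) =
      ∑ α, ∑ σ, epsUp q r i α * epsLo q r j σ * Rm q r c l σ k α := by
  fin_cases i <;> fin_cases k <;> fin_cases l <;> fin_cases j <;>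
    simp [spinorForm, traceMat, Rm, Matrix.mul_apply, Fin.sum_univ_two] <;> ring

/-- `σ̄_±` is `σ` plus a multiple of its quantum trace. -/
theorem sbar_eq (hq : 0 < q) (hr : r ^ 2 < 1) (a : ℝ) (s : Bool)
    (σ : Matrix (Fin 2) (Fin 2) ℂ) (i j : Fin 2) :
    sbar q r a s σ i j = -(if s then (Real.sqrt a : ℂ) else ((Real.sqrt a : ℂ))⁻¹) *
      (σ i j + (if s then ((a : ℂ))⁻¹ else (a : ℂ)) *
        (traceMat q r * σ).trace * if i = j then 1 else 0) := by
  have h := epsLo_mul_epsUp hq hr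
  have h' := mul_eq_one_comm.1 h
  unfold sbar
  generalize (if s then (Real.sqrt a : ℂ) else ((Real.sqrt a : ℂ))⁻¹) = k
  generalize (if s then ((a : ℂ))⁻¹ else (a : ℂ)) = c
  trans k * (epsUpD q r * (epsUp q r)ᵀ * (σ * (epsLo q r * epsUp q r)) +
    (c * (traceMat q r * σ).trace) •
      (epsUpD q r * ((epsUp q r)ᵀ * (epsLo q r * epsUp q r)))) i j
  · refine congrArg _ ?_
    clear h h'
    fin_cases i <;> fin_cases j <;>
    · simp [Fin.sum_univ_two, Rm, traceMat, Matrix.mul_apply, Matrix.trace]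
      ring
  · rw [h, Matrix.mul_one, Matrix.mul_one, epsUpD_eq, neg_mul, ← Matrix.transpose_mul, h']
    simp only [Matrix.transpose_one, Matrix.smul_apply, Matrix.add_apply, Matrix.neg_apply,
      neg_mul, one_mul, smul_eq_mul, Matrix.one_apply]
    ring

/-- The metric pairing is a multiple of `spinorForm`. -/
theorem Gpair_eq (hq : 0 < q) (hr : r ^ 2 < 1) (a : ℝ) (s : Bool)
    (σ τ : Matrix (Fin 2) (Fin 2) ℂ) :
    Gpair q r a s σ τ =
      -(1 / (Qval q r : ℂ) * (if s then (Real.sqrt a : ℂ) else ((Real.sqrt a : ℂ))⁻¹)) *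
        ∑ x : Fin 2 × Fin 2, ∑ y : Fin 2 × Fin 2,
          σ x.1 x.2 * spinorForm q r (if s then ((a : ℂ))⁻¹ else (a : ℂ)) x y * τ y.1 y.2 := by
  simp only [Gpair, sbar_eq hq hr]
  generalize (if s then (Real.sqrt a : ℂ) else ((Real.sqrt a : ℂ))⁻¹) = k
  generalize (if s then ((a : ℂ))⁻¹ else (a : ℂ)) = c
  simp [Fintype.sum_prod_type, Fin.sum_univ_two, spinorForm, traceMat, Matrix.mul_apply,
    Matrix.trace]
  ring

theorem sum_epsLoD_mul_sbar_mul_epsUpD (hq : 0 < q) (hr : r ^ 2 < 1) (a : ℝ) (s : Bool)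
    (σ : Matrix (Fin 2) (Fin 2) ℂ) (i j : Fin 2) :
    ∑ g, ∑ d, epsLoD q r g d * sbar q r a s σ d i * epsUpD q r g j =
      -(if s then (Real.sqrt a : ℂ) else ((Real.sqrt a : ℂ))⁻¹) *
        ∑ x : Fin 2 × Fin 2,
          σ x.1 x.2 * spinorForm q r (if s then ((a : ℂ))⁻¹ else (a : ℂ)) x (i, j) := by
  simp only [sbar_eq hq hr, epsLoD_eq, epsUpD_eq]
  generalize (if s then (Real.sqrt a : ℂ) else ((Real.sqrt a : ℂ))⁻¹) = k
  generalize (if s then ((a : ℂ))⁻¹ else (a : ℂ)) = c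
  fin_cases i <;> fin_cases j <;>
  · simp [Fintype.sum_prod_type, Fin.sum_univ_two, spinorForm, traceMat, Matrix.mul_apply,
      Matrix.trace]
    ring

section Invariance

variable {A : Type*} [Ring A] [Algebra ℂ A] {M Mb : Matrix (Fin 2) (Fin 2) A}

/-- The mixed commutation relation at `c` and unimodularity make `M ⊗ M̄` preserve
`spinorForm q r c`. -/
theorem tensor_transpose_mul_spinorForm_mul (c : ℂ)
    (hM : ∀ α β : Fin 2,
      ∑ γ, ∑ δ, epsUp q r γ δ • (M γ α * M δ β) = epsUp q r α β • (1 : A))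
    (hMb : ∀ α β : Fin 2,
      ∑ γ, ∑ δ, epsUpD q r γ δ • (Mb γ α * Mb δ β) = epsUpD q r α β • (1 : A))
    (hmix : ∀ α σ ρ β : Fin 2,
      ∑ γ, ∑ δ, Rm q r c β δ ρ γ • (M α γ * Mb σ δ) =
        ∑ γ, ∑ δ, Rm q r c γ σ δ α • (Mb δ ρ * M γ β)) :
    (M.tensor Mb)ᵀ * (spinorForm q r c).map (algebraMap ℂ A) * M.tensor Mb =
      (spinorForm q r c).map (algebraMap ℂ A) := by
  have hMb' : ∀ α β : Fin 2,
      ∑ j, ∑ σ, epsLo q r j σ • (Mb σ α * Mb j β) = epsLo q r β α • (1 : A) := by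
    intro α β
    rw [Finset.sum_comm, ← neg_inj]
    simpa only [epsUpD_eq, Matrix.neg_apply, Matrix.transpose_apply, neg_smul,
      Finset.sum_neg_distrib] using hMb α β
  ext ⟨x, x'⟩ ⟨y, y'⟩
  rw [Matrix.transpose_mul_map_mul_apply, Matrix.map_apply, Algebra.algebraMap_eq_smul_one]
  simp only [Fintype.sum_prod_type, Matrix.tensor, Matrix.of_apply]
  calc _ = ∑ i, ∑ j, ∑ α, ∑ σ, (epsUp q r i α * epsLo q r j σ) •
            (M i x * (∑ l, ∑ k, Rm q r c l σ k α • (Mb k x' * M l y)) * Mb j y') := by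
        simp only [spinorForm_eq_sum_Rm, Fin.sum_univ_two, add_smul, mul_add, add_mul, smul_add,
          mul_smul_comm, smul_mul_assoc, smul_smul, mul_assoc]
        abel
    _ = ∑ i, ∑ j, ∑ α, ∑ σ, (epsUp q r i α * epsLo q r j σ) •
            (M i x * (∑ γ, ∑ δ, Rm q r c y δ x' γ • (M α γ * Mb σ δ)) * Mb j y') := by
        simp only [hmix]
    _ = ∑ γ, ∑ δ, Rm q r c y δ x' γ • ((∑ i, ∑ α, epsUp q r i α • (M i x * M α γ)) *
            ∑ j, ∑ σ, epsLo q r j σ • (Mb σ δ * Mb j y')) := by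
        simp only [Fin.sum_univ_two, mul_add, add_mul, smul_add,
          mul_smul_comm, smul_mul_assoc, smul_smul, mul_assoc, mul_comm, mul_left_comm]
        abel
    _ = _ := by
        simp only [hM, hMb', spinorForm_eq_sum_Rm, Finset.sum_smul, smul_mul_assoc, one_mul,
          smul_smul]
        refine Finset.sum_congr rfl fun γ _ => Finset.sum_congr rfl fun δ _ => ?_
        congr 1
        ring

/-- Unimodularity makes `M ⊗ M̄` invertible. -/
theorem isUnit_tensor_of_unimodular (hq : 0 < q) (hr : r ^ 2 < 1)
    (hu1 : ∀ γ δ : Fin 2,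
      ∑ α, ∑ β, epsLo q r α β • (M γ α * M δ β) = epsLo q r γ δ • (1 : A))
    (hu2 : ∀ α β : Fin 2,
      ∑ γ, ∑ δ, epsUp q r γ δ • (M γ α * M δ β) = epsUp q r α β • (1 : A))
    (hu3 : ∀ γ δ : Fin 2,
      ∑ α, ∑ β, epsLoD q r α β • (Mb γ α * Mb δ β) = epsLoD q r γ δ • (1 : A))
    (hu4 : ∀ α β : Fin 2,
      ∑ γ, ∑ δ, epsUpD q r γ δ • (Mb γ α * Mb δ β) = epsUpD q r α β • (1 : A)) :
    IsUnit (M.tensor Mb) := by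
  have h := epsLo_mul_epsUp hq hr
  have hD : epsLoD q r * epsUpD q r = 1 := by
    rw [epsLoD_eq, epsUpD_eq, neg_mul_neg, ← Matrix.transpose_mul, h, Matrix.transpose_one]
  have key : ∀ {Y : Matrix (Fin 2) (Fin 2) A} {G : Matrix (Fin 2) (Fin 2) ℂ},
      (∀ i j, ∑ k, ∑ l, G k l • (Y k i * Y l j) = G i j • (1 : A)) →
        Yᵀ * G.map (algebraMap ℂ A) * Y = G.map (algebraMap ℂ A) := by
    intro Y G hY
    ext i j
    rw [Matrix.transpose_mul_map_mul_apply, hY, Matrix.map_apply, Algebra.algebraMap_eq_smul_one]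
  exact Matrix.isUnit_tensor
    (Matrix.isUnit_of_mul_map_mul_transpose h (key (Y := Mᵀ) hu1) (key hu2))
    (Matrix.isUnit_of_mul_map_mul_transpose hD (key (Y := Mbᵀ) hu3) (key hu4))

end Invariance

section Lorentz

/-- The Pauli matrices as the matrix changing spinor index pairs to vector indices. -/
def pauliMat : Matrix (Fin 2 × Fin 2) (Fin 4) ℂ := .of fun x I => pauli I x.1 x.2

/-- The metric form on spinor index pairs, of which `GupM` is the expression in the Pauli basis. -/
noncomputable def spinorMetric (q r a : ℝ) (s : Bool) : Matrix (Fin 2 × Fin 2) (Fin 2 × Fin 2) ℂ :=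
  (-(1 / (Qval q r : ℂ) * (if s then (Real.sqrt a : ℂ) else ((Real.sqrt a : ℂ))⁻¹))) •
    spinorForm q r (if s then ((a : ℂ))⁻¹ else (a : ℂ))

theorem GupM_eq (hq : 0 < q) (hr : r ^ 2 < 1) (a : ℝ) (s : Bool) :
    GupM q r a s = pauliMatᵀ * spinorMetric q r a s * pauliMat := by
  ext I J
  rw [GupM, Gpair_eq hq hr]
  rw [spinorMetric, Matrix.mul_smul, Matrix.smul_mul, Matrix.smul_apply, smul_eq_mul]
  simp only [Matrix.mul_apply, Finset.sum_mul, Matrix.transpose_apply, pauliMat, Matrix.of_apply]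
  rw [Finset.sum_comm]

/-- The inverse of `pauliMat`, expressed through the metric. -/
noncomputable def pauliInv (q r a : ℝ) : Matrix (Fin 4) (Fin 2 × Fin 2) ℂ :=
  GloM q r a true * pauliMatᵀ * spinorMetric q r a true

theorem pauliInv_mul (hq : 0 < q) (hr : r ^ 2 < 1) {a : ℝ}
    (hG : IsUnit (GupM q r a true).det) : pauliInv q r a * pauliMat = 1 := by
  rw [pauliInv, Matrix.mul_assoc, Matrix.mul_assoc, ← Matrix.mul_assoc pauliMatᵀ,
    ← GupM_eq hq hr, GloM, Matrix.nonsing_inv_mul _ hG]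

theorem mul_pauliInv (hq : 0 < q) (hr : r ^ 2 < 1) {a : ℝ}
    (hG : IsUnit (GupM q r a true).det) : pauliMat * pauliInv q r a = 1 :=
  (Matrix.mul_eq_one_comm_of_equiv finProdFinEquiv.symm).1 (pauliInv_mul hq hr hG)

variable {A : Type*} [Ring A] [Algebra ℂ A]

/-- The Lorentz generators are the matrix of `M ⊗ M̄` in the Pauli basis. -/
theorem Lor_eq (hq : 0 < q) (hr : r ^ 2 < 1) (a : ℝ) (M Mb : Matrix (Fin 2) (Fin 2) A) :
    (Matrix.of (Lor q r a M Mb) : Matrix (Fin 4) (Fin 4) A) =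
      (pauliInv q r a).map (algebraMap ℂ A) * M.tensor Mb * pauliMat.map (algebraMap ℂ A) := by
  ext L K
  have hU : ∀ i j, pauliInv q r a L (i, j) = 1 / (Qval q r : ℂ) *
      ∑ g, ∑ d, epsLoD q r g d * sbarL q r a L d i * epsUpD q r g j := by
    intro i j
    trans ∑ N, GloM q r a true L N * (1 / (Qval q r : ℂ) *
      ∑ g, ∑ d, epsLoD q r g d * sbar q r a true (pauli N) d i * epsUpD q r g j)
    · simp only [sum_epsLoD_mul_sbar_mul_epsUpD hq hr]
      rw [pauliInv, Matrix.mul_assoc, Matrix.mul_apply]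
      refine Finset.sum_congr rfl fun N _ => congrArg _ ?_
      rw [spinorMetric, Matrix.mul_smul, Matrix.smul_apply, smul_eq_mul, Matrix.mul_apply]
      simp only [Matrix.transpose_apply, pauliMat, Matrix.of_apply]
      ring
    · simp only [sbarL, Finset.mul_sum, Finset.sum_mul]
      rw [Finset.sum_comm]
      refine Finset.sum_congr rfl fun g _ => ?_
      rw [Finset.sum_comm]
      refine Finset.sum_congr rfl fun d _ => Finset.sum_congr rfl fun N _ => ?_
      ring
  trans ∑ al, ∑ be, ∑ sg, ∑ rh,
    (pauliInv q r a L (al, be) * pauli K sg rh) • (M al sg * Mb be rh)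
  · simp only [Matrix.of_apply, Lor, hU, Fin.sum_univ_two, mul_add, add_smul, mul_assoc,
      mul_comm, mul_left_comm]
    abel
  · simp only [Matrix.mul_apply, Matrix.map_apply, Algebra.algebraMap_eq_smul_one, Matrix.tensor,
      Fintype.sum_prod_type, pauliMat, Matrix.of_apply, smul_mul_assoc, one_mul, mul_smul_comm,
      mul_one, Fin.sum_univ_two, smul_add, smul_smul, mul_comm]
    abel

/-- Passing to the Pauli basis preserves invertibility. -/
theorem isUnit_Lor (hq : 0 < q) (hr : r ^ 2 < 1) {a : ℝ} (hG : IsUnit (GupM q r a true).det)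
    {M Mb : Matrix (Fin 2) (Fin 2) A} (hX : IsUnit (M.tensor Mb)) :
    IsUnit (Matrix.of (Lor q r a M Mb) : Matrix (Fin 4) (Fin 4) A) := by
  rw [Lor_eq hq hr]
  generalize M.tensor Mb = X at hX
  obtain ⟨⟨X, Z, hXZ, hZX⟩, rfl⟩ := hX
  set t := pauliMat.map (algebraMap ℂ A)
  set u := (pauliInv q r a).map (algebraMap ℂ A)
  have hut : u * t = 1 := by
    rw [← Matrix.map_mul, pauliInv_mul hq hr hG, Matrix.map_one _ (map_zero _) (map_one _)]
  have htu : t * u = 1 := by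
    rw [← Matrix.map_mul, mul_pauliInv hq hr hG, Matrix.map_one _ (map_zero _) (map_one _)]
  refine ⟨⟨u * X * t, u * Z * t, ?_, ?_⟩, rfl⟩
  · calc u * X * t * (u * Z * t) = u * (X * ((t * u) * (Z * t))) := by
          simp only [Matrix.mul_assoc]
      _ = 1 := by rw [htu, Matrix.one_mul, ← Matrix.mul_assoc X, hXZ, Matrix.one_mul, hut]
  · calc u * Z * t * (u * X * t) = u * (Z * ((t * u) * (X * t))) := by
          simp only [Matrix.mul_assoc]
      _ = 1 := by rw [htu, Matrix.one_mul, ← Matrix.mul_assoc Z, hZX, Matrix.one_mul, hut]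

/-- If `M ⊗ M̄` preserves `spinorForm`, the Lorentz generators preserve the metric. -/
theorem Lor_transpose_mul_GupM_mul (hq : 0 < q) (hr : r ^ 2 < 1) {a : ℝ}
    (hG : IsUnit (GupM q r a true).det) (s : Bool) {M Mb : Matrix (Fin 2) (Fin 2) A}
    (hX : (M.tensor Mb)ᵀ *
        (spinorForm q r (if s then ((a : ℂ))⁻¹ else (a : ℂ))).map (algebraMap ℂ A) * M.tensor Mb =
      (spinorForm q r (if s then ((a : ℂ))⁻¹ else (a : ℂ))).map (algebraMap ℂ A)) :
    (Matrix.of (Lor q r a M Mb) : Matrix (Fin 4) (Fin 4) A)ᵀ *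
        (GupM q r a s).map (algebraMap ℂ A) * Matrix.of (Lor q r a M Mb) =
      (GupM q r a s).map (algebraMap ℂ A) := by
  set Λ : Matrix (Fin 4) (Fin 4) A := Matrix.of (Lor q r a M Mb) with hΛ
  set X := M.tensor Mb
  set t := pauliMat.map (algebraMap ℂ A)
  have htΛ : t * Λ = X * t := by
    rw [hΛ, Lor_eq hq hr, ← Matrix.mul_assoc, ← Matrix.mul_assoc, ← Matrix.map_mul,
      mul_pauliInv hq hr hG, Matrix.map_one _ (map_zero _) (map_one _), Matrix.one_mul]
  have hB : Xᵀ * (spinorMetric q r a s).map (algebraMap ℂ A) * X =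
      (spinorMetric q r a s).map (algebraMap ℂ A) := by
    have hk : ∀ (k : ℂ) (F : Matrix (Fin 2 × Fin 2) (Fin 2 × Fin 2) ℂ),
        (k • F).map (algebraMap ℂ A) = k • F.map (algebraMap ℂ A) := fun k F => by
      ext
      rw [Matrix.map_apply, Matrix.smul_apply, Matrix.smul_apply, Matrix.map_apply, smul_eq_mul,
        map_mul, Algebra.smul_def]
    rw [spinorMetric, hk, Matrix.mul_smul, Matrix.smul_mul, hX]
  rw [GupM_eq hq hr, Matrix.map_mul, Matrix.map_mul]
  calc _ = (Λᵀ * pauliMatᵀ.map (algebraMap ℂ A)) *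
          (spinorMetric q r a s).map (algebraMap ℂ A) * (t * Λ) := by
        simp only [Matrix.mul_assoc, t]
    _ = pauliMatᵀ.map (algebraMap ℂ A) *
          (Xᵀ * (spinorMetric q r a s).map (algebraMap ℂ A) * X) * t := by
        rw [← Matrix.transpose_map_algebraMap_mul, htΛ, Matrix.transpose_mul_map_algebraMap]
        simp only [Matrix.mul_assoc]
    _ = _ := by rw [hB]

end Lorentz

end SpinorMetric

/-- the Lorentz generators satisfy the orthogonality relations
`Σ G_{±NM} Λ_L^N Λ_K^M = G_{±LK}·1` and `Σ G_±^{LK} Λ_L^N Λ_K^M = G_±^{NM}·1`. -/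
theorem lorentz_orthogonality (q r : ℝ) (hq : 0 < q) (hr : r ^ 2 < 1)
    (a : ℝ) (ha : 0 < a) (haQ : a + a⁻¹ = Qval q r)
    (hG : ∀ s, IsUnit (GupM q r a s).det)
    {A : Type*} [Ring A] [Algebra ℂ A] (M Mb : Fin 2 → Fin 2 → A)
    (hu1 : ∀ γ δ : Fin 2,
      ∑ α, ∑ β, epsLo q r α β • (M γ α * M δ β) = epsLo q r γ δ • (1 : A))
    (hu2 : ∀ α β : Fin 2,
      ∑ γ, ∑ δ, epsUp q r γ δ • (M γ α * M δ β) = epsUp q r α β • (1 : A))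
    (hu3 : ∀ γ δ : Fin 2,
      ∑ α, ∑ β, epsLoD q r α β • (Mb γ α * Mb δ β) = epsLoD q r γ δ • (1 : A))
    (hu4 : ∀ α β : Fin 2,
      ∑ γ, ∑ δ, epsUpD q r γ δ • (Mb γ α * Mb δ β) = epsUpD q r α β • (1 : A))
    (hmix : ∀ c : ℂ, (c = (a : ℂ) ∨ c = ((a : ℂ))⁻¹) →
      ∀ α σ ρ β : Fin 2,
        ∑ γ, ∑ δ, Rm q r c β δ ρ γ • (M α γ * Mb σ δ) =
          ∑ γ, ∑ δ, Rm q r c γ σ δ α • (Mb δ ρ * M γ β)) :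
    ∀ s : Bool,
      (∀ L K : Fin 4,
        ∑ N, ∑ M', GloM q r a s N M' • (Lor q r a M Mb L N * Lor q r a M Mb K M') =
          GloM q r a s L K • (1 : A)) ∧
      (∀ N M' : Fin 4,
        ∑ L, ∑ K, GupM q r a s L K • (Lor q r a M Mb L N * Lor q r a M Mb K M') =
          GupM q r a s N M' • (1 : A)) := by
  intro s
  have hΛ := isUnit_Lor hq hr (hG true) (isUnit_tensor_of_unimodular hq hr hu1 hu2 hu3 hu4)
  have h := Lor_transpose_mul_GupM_mul hq hr (hG true) s
    (tensor_transpose_mul_spinorForm_mul _ hu2 hu4 (hmix _ (by cases s <;> simp)))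
  simp only [← Algebra.algebraMap_eq_smul_one]
  refine ⟨fun L K => ?_, fun N M' => ?_⟩
  · have h' := congrFun (congrFun (Matrix.mul_map_inv_mul_transpose hΛ (hG s) h) L) K
    rw [← Matrix.transpose_transpose (Matrix.of (Lor q r a M Mb)),
      Matrix.transpose_transpose (Matrix.transpose _),
      Matrix.transpose_mul_map_mul_apply] at h'
    exact h'
  · have h' := congrFun (congrFun h N) M'
    rw [Matrix.transpose_mul_map_mul_apply] at h'
    exact h'
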